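/- Let p ≥ 1 and k ≥ 1 be integers and 0 ≤ q ≤ p−1 an integer, with equally spaced knots s_i = i/k (i = 0,…,k) on [0,1], and for each order m ≥ 1 let φ_i^{(m)} be the order-m O-spline basis function with these knots (φ_i^{(m)}(x) = 0 for x ≤ s_{i−1}; (x−s_{i−1})^m/m! for s_{i−1} < x ≤ s_i; ((x−s_{i−1})^m − (x−s_i)^m)/m! for x > s_i). Then sup over s, t ∈ [0,1] of | ∫₀^{min(s,t)} (s−u)^{p−1}(t−u)^{p−1−q} / ((p−1)!·(p−1−q)!) du − k·Σ_{i=1}^k φ_i^{(p)}(s)·φ_i^{(p−q)}(t) | ≤ 2/k. (The first term is the cross-covariance C^{(0,q)}(s,t) = Cov[g(s), g^{(q)}(t)] of the p-th order integrated Wiener process g with σ = 1 and its q-th derivative; the second is the corresponding cross-covariance C_k^{(0,q)}(s,t) of the O-spline approximation g̃_k and its q-th derivative; so ||C^{(0,q)} − C_k^{(0,q)}||_∞ = O(1/k).) -/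

import Mathlib

open MeasureTheory Finset

/-- The order-`m` O-spline basis function with equally spaced knots `s_i = i/k` on `[0,1]`,
associated to the knot interval `(s_{i-1}, s_i]`. -/
noncomputable def ospline (m k i : ℕ) (x : ℝ) : ℝ :=
  if x ≤ ((i : ℝ) - 1) / k then 0
  else if x ≤ (i : ℝ) / k then (x - ((i : ℝ) - 1) / k) ^ m / (Nat.factorial m)
  else ((x - ((i : ℝ) - 1) / k) ^ m - (x - (i : ℝ) / k) ^ m) / (Nat.factorial m)


noncomputable def tpow (n : ℕ) (x u : ℝ) : ℝ :=
  if u ≤ x then (x - u) ^ n / (Nat.factorial n) else 0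

lemma tpow_nonneg (n : ℕ) (x u : ℝ) : 0 ≤ tpow n x u := by
  unfold tpow
  split_ifs with h
  · have : 0 ≤ x - u := by linarith
    positivity
  · exact le_rfl

lemma tpow_antitone (n : ℕ) (x : ℝ) : Antitone (tpow n x) := by
  intro u v huv
  by_cases h : v ≤ x
  · have h' : u ≤ x := huv.trans h
    have : 0 ≤ x - v := by linarith
    simp only [tpow, h, h', if_true]
    gcongr
  · have : tpow n x v = 0 := by simp [tpow, h]
    rw [this]
    exact tpow_nonneg n x u

lemma tpow_le_one (n : ℕ) (x u : ℝ) (hx : x ≤ 1) (hu : 0 ≤ u) : tpow n x u ≤ 1 := by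
  unfold tpow
  split_ifs with h
  · have h0 : 0 ≤ x - u := by linarith
    have h1 : (x - u) ^ n ≤ 1 := pow_le_one₀ h0 (by linarith)
    have h2 : (1 : ℝ) ≤ (Nat.factorial n : ℝ) := by
      exact_mod_cast Nat.succ_le_of_lt (Nat.factorial_pos n)
    rw [div_le_one (by linarith)]
    linarith
  · exact zero_le_one

lemma tpow_int (n : ℕ) (x c d : ℝ) : IntervalIntegrable (tpow n x) volume c d :=
  (tpow_antitone n x).intervalIntegrable

lemma tpow_mul_int (n m : ℕ) (x y c d : ℝ) :
    IntervalIntegrable (fun u => tpow n x u * tpow m y u) volume c d := by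
  apply Antitone.intervalIntegrable
  intro u v huv
  exact mul_le_mul (tpow_antitone n x huv) (tpow_antitone m y huv) (tpow_nonneg _ _ _)
    (tpow_nonneg _ _ _)

lemma tpow_integral_zero (n : ℕ) (x c d : ℝ) (hcd : c ≤ d) (hx : x ≤ c) :
    ∫ u in c..d, tpow n x u = 0 := by
  apply intervalIntegral.integral_zero_ae
  refine Filter.Eventually.of_forall fun u hu => ?_
  rw [Set.uIoc_of_le hcd] at hu
  have : ¬ u ≤ x := by have := hu.1; linarith
  simp [tpow, this]

lemma tpow_integral_full (n : ℕ) (x c d : ℝ) (hcd : c ≤ d) (hx : d ≤ x) :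
    ∫ u in c..d, tpow n x u =
      ((x - c) ^ (n + 1) - (x - d) ^ (n + 1)) / (Nat.factorial (n + 1)) := by
  have h1 : ∫ u in c..d, tpow n x u = ∫ u in c..d, (x - u) ^ n / (Nat.factorial n : ℝ) := by
    apply intervalIntegral.integral_congr
    intro u hu
    rw [Set.uIcc_of_le hcd] at hu
    have : u ≤ x := hu.2.trans hx
    simp [tpow, this]
  rw [h1, intervalIntegral.integral_div,
    intervalIntegral.integral_comp_sub_left (fun u => u ^ n) x, integral_pow, Nat.factorial_succ]
  push_cast
  have : (Nat.factorial n : ℝ) ≠ 0 := by positivity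
  field_simp

lemma ospline_eq (n k i : ℕ) (hk : 1 ≤ k) (x : ℝ) :
    ospline (n + 1) k i x = ∫ u in (((i : ℝ) - 1) / k)..((i : ℝ) / k), tpow n x u := by
  have hcd : ((i : ℝ) - 1) / k ≤ (i : ℝ) / k := by gcongr; linarith
  unfold ospline
  split_ifs with h1 h2
  · rw [tpow_integral_zero _ _ _ _ hcd h1]
  · push Not at h1
    rw [← intervalIntegral.integral_add_adjacent_intervals (tpow_int n x _ x) (tpow_int n x x _),
      tpow_integral_zero _ _ _ _ h2 le_rfl, tpow_integral_full _ _ _ _ h1.le le_rfl]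
    simp
  · push Not at h2
    rw [tpow_integral_full _ _ _ _ hcd h2.le]

lemma local_bound (n m : ℕ) (x y c d K : ℝ) (hK : 0 < K) (hd : d = c + 1 / K) (hc : 0 ≤ c)
    (hy : y ≤ 1) :
    |(∫ u in c..d, tpow n x u * tpow m y u) -
      K * ((∫ u in c..d, tpow n x u) * ∫ u in c..d, tpow m y u)|
      ≤ (tpow n x c - tpow n x d) / K := by
  have hK' : 0 < 1 / K := by positivity
  have hcd : c ≤ d := by linarith
  have hdc : d - c = 1 / K := by linarith
  have hanti := tpow_antitone n x
  set A := ∫ u in c..d, tpow n x u with hA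
  set B := ∫ u in c..d, tpow m y u with hB
  have hB0 : 0 ≤ B := intervalIntegral.integral_nonneg hcd fun u _ => tpow_nonneg _ _ _
  have hB1 : B ≤ 1 / K := by
    have := intervalIntegral.integral_mono_on hcd (tpow_int m y c d)
      (intervalIntegrable_const (c := (1 : ℝ)))
      (fun u hu => tpow_le_one m y u hy (hc.trans hu.1))
    simpa [hdc] using this
  have hA1 : A ≤ tpow n x c / K := by
    have := intervalIntegral.integral_mono_on hcd (tpow_int n x c d)
      (intervalIntegrable_const (c := tpow n x c)) (fun u hu => hanti hu.1)
    rw [intervalIntegral.integral_const, hdc, smul_eq_mul] at this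
    calc A ≤ _ := this
      _ = _ := by ring
  have hA2 : tpow n x d / K ≤ A := by
    have := intervalIntegral.integral_mono_on hcd
      (intervalIntegrable_const (c := tpow n x d)) (tpow_int n x c d) (fun u hu => hanti hu.2)
    rw [intervalIntegral.integral_const, hdc, smul_eq_mul] at this
    calc _ = 1 / K * tpow n x d := by ring
      _ ≤ _ := this
  have hP1 : (∫ u in c..d, tpow n x u * tpow m y u) ≤ tpow n x c * B := by
    rw [hB, ← intervalIntegral.integral_const_mul]
    exact intervalIntegral.integral_mono_on hcd (tpow_mul_int n m x y c d)
      ((tpow_int m y c d).const_mul _)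
      (fun u hu => mul_le_mul_of_nonneg_right (hanti hu.1) (tpow_nonneg _ _ _))
  have hP2 : tpow n x d * B ≤ (∫ u in c..d, tpow n x u * tpow m y u) := by
    rw [hB, ← intervalIntegral.integral_const_mul]
    exact intervalIntegral.integral_mono_on hcd ((tpow_int m y c d).const_mul _)
      (tpow_mul_int n m x y c d)
      (fun u hu => mul_le_mul_of_nonneg_right (hanti hu.2) (tpow_nonneg _ _ _))
  have hKA1 : K * A ≤ tpow n x c := by
    rw [le_div_iff₀ hK] at hA1; linarith
  have hKA2 : tpow n x d ≤ K * A := by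
    rw [div_le_iff₀ hK] at hA2; linarith
  have e1 := mul_le_mul_of_nonneg_right hKA1 hB0
  have e2 := mul_le_mul_of_nonneg_right hKA2 hB0
  have e3 : (tpow n x c - tpow n x d) * B ≤ (tpow n x c - tpow n x d) * (1 / K) :=
    mul_le_mul_of_nonneg_left hB1 (by have := hanti hcd; linarith)
  have e4 : (tpow n x c - tpow n x d) / K = (tpow n x c - tpow n x d) * (1 / K) := by ring
  rw [e4, abs_le]
  constructor <;> nlinarith

/-- Lemma 2 (Convergence of Cross-Covariance) on `Ω = [0,1]`: the cross-covariance of the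
order-`p` O-spline approximation and its `q`-th derivative,
`k ∑ φ_i^{(p)}(s) φ_i^{(p-q)}(t)`, is uniformly within `2/k` of the cross-covariance
`∫₀^{min(s,t)} (s-u)^{p-1}(t-u)^{p-1-q}/((p-1)!(p-1-q)!) du` of the `p`-th order integrated
Wiener process (with `σ = 1`) and its `q`-th derivative. -/
theorem ospline_cross_covariance_convergence (p k : ℕ) (hp : 1 ≤ p) (hk : 1 ≤ k)
    (q : ℕ) (hq : q ≤ p - 1)
    (s t : ℝ) (hs : s ∈ Set.Icc (0 : ℝ) 1) (ht : t ∈ Set.Icc (0 : ℝ) 1) :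
    |(∫ u in (0 : ℝ)..min s t,
        (s - u) ^ (p - 1) * (t - u) ^ (p - 1 - q) /
          ((Nat.factorial (p - 1) : ℝ) * (Nat.factorial (p - 1 - q) : ℝ))) -
      (k : ℝ) * ∑ i ∈ Finset.Icc 1 k, ospline p k i s * ospline (p - q) k i t| ≤ 2 / k := by
  obtain ⟨n, rfl⟩ : ∃ n, p = n + 1 := ⟨p - 1, by omega⟩
  obtain ⟨m, hm⟩ : ∃ m, n + 1 - q = m + 1 := ⟨n - q, by omega⟩
  have hm' : n + 1 - 1 - q = m := by omega
  rw [hm, hm', Nat.add_sub_cancel]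
  have hk0 : (0 : ℝ) < k := by exact_mod_cast hk
  have hmin0 : 0 ≤ min s t := le_min hs.1 ht.1
  have hmin1 : min s t ≤ 1 := (min_le_left _ _).trans hs.2
  -- the integral as an integral over the unit interval
  have hI : (∫ u in (0 : ℝ)..min s t,
        (s - u) ^ n * (t - u) ^ m / ((Nat.factorial n : ℝ) * (Nat.factorial m : ℝ)))
      = ∫ u in (0 : ℝ)..1, tpow n s u * tpow m t u := by
    rw [← intervalIntegral.integral_add_adjacent_intervals
      (tpow_mul_int n m s t 0 (min s t)) (tpow_mul_int n m s t (min s t) 1)]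
    have hz : ∫ u in (min s t)..1, tpow n s u * tpow m t u = 0 := by
      apply intervalIntegral.integral_zero_ae
      refine Filter.Eventually.of_forall fun u hu => ?_
      rw [Set.uIoc_of_le hmin1] at hu
      rcases min_lt_iff.1 hu.1 with h | h
      · simp [tpow, not_le.2 h]
      · simp [tpow, not_le.2 h]
    rw [hz, add_zero]
    apply intervalIntegral.integral_congr
    intro u hu
    rw [Set.uIcc_of_le hmin0] at hu
    have h1 : u ≤ s := hu.2.trans (min_le_left _ _)
    have h2 : u ≤ t := hu.2.trans (min_le_right _ _)
    simp only [tpow, h1, h2, if_true]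
    rw [div_mul_div_comm]
  -- split into knot intervals
  have hsplit : ∫ u in (0 : ℝ)..1, tpow n s u * tpow m t u
      = ∑ j ∈ Finset.range k, ∫ u in ((j : ℝ) / k)..(((j + 1 : ℕ) : ℝ) / k),
          tpow n s u * tpow m t u := by
    rw [intervalIntegral.sum_integral_adjacent_intervals (a := fun j : ℕ => (j : ℝ) / k)
      (fun j _ => tpow_mul_int n m s t _ _)]
    simp [hk0.ne']
  have hsum : ∑ i ∈ Finset.Icc 1 k, ospline (n + 1) k i s * ospline (m + 1) k i t
      = ∑ j ∈ Finset.range k, (∫ u in ((j : ℝ) / k)..(((j + 1 : ℕ) : ℝ) / k), tpow n s u) *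
          ∫ u in ((j : ℝ) / k)..(((j + 1 : ℕ) : ℝ) / k), tpow m t u := by
    have hset : Finset.Icc 1 k = Finset.Ico 1 (k + 1) := by ext; simp
    rw [hset, Finset.sum_Ico_eq_sum_range, Nat.add_sub_cancel]
    refine Finset.sum_congr rfl fun j _ => ?_
    have hj : (((1 + j : ℕ) : ℝ) - 1) = j := by push_cast; ring
    rw [ospline_eq n k _ hk, ospline_eq m k _ hk, hj, add_comm 1 j]
  rw [hI, hsplit, hsum, Finset.mul_sum, ← Finset.sum_sub_distrib]
  calc _ ≤ ∑ j ∈ Finset.range k, (tpow n s ((j : ℝ) / k) - tpow n s (((j + 1 : ℕ) : ℝ) / k)) / k := by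
        refine (Finset.abs_sum_le_sum_abs _ _).trans (Finset.sum_le_sum fun j _ => ?_)
        exact local_bound n m s t _ _ k hk0 (by push_cast; ring) (by positivity) ht.2
    _ = (tpow n s 0 - tpow n s 1) / k := by
        rw [← Finset.sum_div, Finset.sum_range_sub' (fun j : ℕ => tpow n s ((j : ℝ) / k))]
        simp [hk0.ne']
    _ ≤ 2 / k := by
        have h1 := tpow_le_one n s 0 hs.2 le_rfl
        have h2 := tpow_nonneg n s 1
        gcongr
        linarith
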